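/- Let β=(β¹,β²) be smooth real functions on ℝ³ and write (e₀) = ∂_t − βⁱ∂_i. Let wₙ be C¹ and vₙ be C² real functions on ℝ³ (n∈ℕ) such that for every compact K⊂ℝ³: ‖wₙ‖_{L^∞(K)} → 0, ‖∂_{x^i}wₙ‖_{L^∞(K)} → 0 for i=1,2, and sup_n ‖∂vₙ‖_{L²(K)} < ∞. Then for every ϑ∈C_c^∞(ℝ³) and each j∈{1,2}, ∫_{ℝ³} ϑ·((e₀)wₙ)·(∂_jvₙ) dx → 0 as n→∞; that is, ((e₀)wₙ)·∂_jvₙ ⇀ 0 in the sense of distributions even though (e₀)wₙ need not converge strongly. -/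

import Mathlib

open MeasureTheory Real Filter
open scoped ENNReal

noncomputable section

abbrev E3 : Type := Fin 3 → ℝ

/-- Partial derivative in coordinate direction `α` (direction `0` is time, `1`, `2` spatial). -/
noncomputable def pd (α : Fin 3) (f : E3 → ℝ) (x : E3) : ℝ :=
  fderiv ℝ f x (Pi.single α 1)

/-- The vector field `(e₀) = ∂_t − βⁱ∂_i` applied to `f`. -/
noncomputable def e0 (b : Fin 2 → E3 → ℝ) (f : E3 → ℝ) (x : E3) : ℝ :=
  pd 0 f x - (b 0 x * pd 1 f x + b 1 x * pd 2 f x)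

lemma continuous_pd {f : E3 → ℝ} (hf : ContDiff ℝ 1 f) (α : Fin 3) : Continuous (pd α f) :=
  (hf.continuous_fderiv one_ne_zero).clm_apply continuous_const

lemma contDiff_pd {f : E3 → ℝ} (hf : ContDiff ℝ 2 f) (α : Fin 3) : ContDiff ℝ 1 (pd α f) :=
  (hf.fderiv_right (m := 1) (by norm_num)).clm_apply contDiff_const

lemma tsupport_pd_subset (f : E3 → ℝ) (α : Fin 3) : tsupport (pd α f) ⊆ tsupport f :=
  tsupport_fderiv_apply_subset ℝ (Pi.single α 1)

lemma pd_mul {f g : E3 → ℝ} (hf : ContDiff ℝ 1 f) (hg : ContDiff ℝ 1 g) (α : Fin 3) (x : E3) :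
    pd α (fun y => f y * g y) x = f x * pd α g x + pd α f x * g x := by
  have hf' := hf.differentiable one_ne_zero x
  have hg' := hg.differentiable one_ne_zero x
  simp only [pd]
  rw [fderiv_fun_mul hf' hg']
  simp [mul_comm]

lemma pd_comm {f : E3 → ℝ} (hf : ContDiff ℝ 2 f) (α β : Fin 3) (x : E3) :
    pd α (pd β f) x = pd β (pd α f) x := by
  have hsymm : IsSymmSndFDerivAt ℝ f x :=
    hf.contDiffAt.isSymmSndFDerivAt (by simp)
  have key : ∀ γ δ : Fin 3, pd γ (pd δ f) x =
      fderiv ℝ (fderiv ℝ f) x (Pi.single γ 1) (Pi.single δ 1) := by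
    intro γ δ
    have hd : DifferentiableAt ℝ (fderiv ℝ f) x :=
      (hf.fderiv_right (m := 1) (by norm_num)).differentiable one_ne_zero x
    change fderiv ℝ (fun y => fderiv ℝ f y (Pi.single δ 1)) x (Pi.single γ 1) = _
    rw [fderiv_clm_apply hd (differentiableAt_const _)]
    simp
  rw [key, key, hsymm]

lemma integral_mul_pd {f g : E3 → ℝ} (hf : ContDiff ℝ 1 f) (hg : ContDiff ℝ 1 g)
    (hfc : HasCompactSupport f) (α : Fin 3) :
    ∫ x, f x * pd α g x = -∫ x, pd α f x * g x := by
  refine integral_mul_fderiv_eq_neg_fderiv_mul_of_integrable ?_ ?_ ?_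
    (fun x _ => hf.differentiable one_ne_zero x) (fun x _ => hg.differentiable one_ne_zero x)
  · exact ((continuous_pd hf α).mul hg.continuous).integrable_of_hasCompactSupport
      (HasCompactSupport.mul_right (hfc.fderiv_apply ℝ (Pi.single α 1)))
  · exact (hf.continuous.mul (continuous_pd hg α)).integrable_of_hasCompactSupport hfc.mul_right
  · exact (hf.continuous.mul hg.continuous).integrable_of_hasCompactSupport hfc.mul_right

/-- The null structure `∂_α f ∂_β v - ∂_β f ∂_α v` integrates to zero. -/
lemma integral_pd_mul_pd_comm {f v : E3 → ℝ} (hf : ContDiff ℝ 1 f) (hv : ContDiff ℝ 2 v)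
    (hfc : HasCompactSupport f) (α β : Fin 3) :
    ∫ x, pd α f x * pd β v x = ∫ x, pd β f x * pd α v x := by
  have h₁ := integral_mul_pd hf (contDiff_pd hv β) hfc α
  have h₂ := integral_mul_pd hf (contDiff_pd hv α) hfc β
  simp only [pd_comm hv α β] at h₁
  exact neg_injective (h₁.symm.trans h₂)

lemma exists_setIntegral_norm_le {u : ℕ → E3 → ℝ} (hu : ∀ n, Continuous (u n)) {K : Set E3}
    (hK : IsCompact K) {C : ℝ}
    (hC : ∀ n, eLpNorm (u n) 2 (volume.restrict K) ≤ ENNReal.ofReal C) :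
    ∃ D : ℝ, 0 ≤ D ∧ ∀ n, ∫ x in K, ‖u n x‖ ≤ D := by
  set r : ℝ := 1 / (1 : ℝ≥0∞).toReal - 1 / (2 : ℝ≥0∞).toReal
  have hr : 0 ≤ r := by norm_num [r]
  refine ⟨(ENNReal.ofReal C * (volume.restrict K) Set.univ ^ r).toReal,
    ENNReal.toReal_nonneg, fun n => ?_⟩
  have hm : AEStronglyMeasurable (u n) (volume.restrict K) := (hu n).aestronglyMeasurable
  rw [integral_norm_eq_lintegral_enorm hm, ← eLpNorm_one_eq_lintegral_enorm]
  refine ENNReal.toReal_mono (ENNReal.mul_ne_top ENNReal.ofReal_ne_top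
    (ENNReal.rpow_ne_top_of_nonneg hr ?_)) ?_
  · rw [Measure.restrict_apply_univ]
    exact hK.measure_lt_top.ne
  · exact (eLpNorm_le_eLpNorm_mul_rpow_measure_univ one_le_two hm).trans (by gcongr; exact hC n)

/-- A locally uniformly null sequence times an `L²`-bounded sequence is null in the sense of
distributions. -/
lemma tendsto_integral_mul_of_tendstoUniformlyOn {g : E3 → ℝ} {h u : ℕ → E3 → ℝ}
    {K : Set E3} (hg : Continuous g) (hu : ∀ n, Continuous (u n)) (hK : IsCompact K)
    (hgK : ∀ x, x ∉ K → g x = 0) (hh : TendstoUniformlyOn h 0 atTop K) {C : ℝ}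
    (hC : ∀ n, eLpNorm (u n) 2 (volume.restrict K) ≤ ENNReal.ofReal C) :
    Tendsto (fun n => ∫ x, g x * h n x * u n x) atTop (nhds 0) := by
  obtain ⟨D, hD, hDu⟩ := exists_setIntegral_norm_le hu hK hC
  obtain ⟨M, hM⟩ := hK.exists_bound_of_continuousOn hg.continuousOn
  have hM' : ∀ x ∈ K, ‖g x‖ ≤ |M| := fun x hx => (hM x hx).trans (le_abs_self M)
  rw [Metric.tendsto_nhds]
  intro ε hε
  have hpos : 0 < |M| * D + 1 := by positivity
  set δ := ε / (|M| * D + 1)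
  have hδ : 0 < δ := div_pos hε hpos
  filter_upwards [Metric.tendstoUniformlyOn_iff.1 hh δ hδ] with n hn
  have hhn : ∀ x ∈ K, ‖h n x‖ ≤ δ := fun x hx => by
    simpa [dist_eq_norm] using (hn x hx).le
  rw [dist_zero_right, ← setIntegral_eq_integral_of_forall_compl_eq_zero (s := K)
    (fun x hx => by simp [hgK x hx])]
  calc ‖∫ x in K, g x * h n x * u n x‖
      ≤ ∫ x in K, |M| * δ * ‖u n x‖ := by
        refine norm_integral_le_of_norm_le
          (((hu n).norm.continuousOn.integrableOn_compact hK).const_mul _) ?_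
        filter_upwards [ae_restrict_mem hK.measurableSet] with x hx
        rw [norm_mul, norm_mul]
        gcongr
        exacts [hM' x hx, hhn x hx]
    _ = |M| * δ * ∫ x in K, ‖u n x‖ := integral_const_mul _ _
    _ ≤ |M| * δ * D := by gcongr; exact hDu n
    _ < δ * (|M| * D + 1) := by linarith
    _ = ε := div_mul_cancel₀ ε hpos.ne'

/-- Integration by parts moves the time derivative off `w`, at the cost of exchanging it with the
spatial derivative falling on `v`. -/
lemma integral_e0_mul_pd {b : Fin 2 → E3 → ℝ} (hb : ∀ i, Continuous (b i)) {w v ϑ : E3 → ℝ}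
    (hw : ContDiff ℝ 1 w) (hv : ContDiff ℝ 2 v) (hϑ : ContDiff ℝ 1 ϑ)
    (hϑc : HasCompactSupport ϑ) (j : Fin 3) :
    ∫ x, ϑ x * e0 b w x * pd j v x =
      (∫ x, ϑ x * pd j w x * pd 0 v x) + (∫ x, pd j ϑ x * w x * pd 0 v x)
        - (∫ x, pd 0 ϑ x * w x * pd j v x) - (∫ x, (ϑ x * b 0 x) * pd 1 w x * pd j v x)
        - ∫ x, (ϑ x * b 1 x) * pd 2 w x * pd j v x := by
  have integrable_prod : ∀ {f g k : E3 → ℝ}, Continuous f → Continuous g → Continuous k →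
      HasCompactSupport f → Integrable (fun x => f x * g x * k x) := fun hf hg hk hc =>
    ((hf.mul hg).mul hk).integrable_of_hasCompactSupport (hc.mul_right.mul_right)
  have hv₁ : ∀ α, Continuous (pd α v) := continuous_pd (hv.of_le one_le_two)
  have hw₁ : ∀ α, Continuous (pd α w) := continuous_pd hw
  have hϑ₁ : ∀ α, Continuous (pd α ϑ) := continuous_pd hϑ
  have hϑ₁c : ∀ α, HasCompactSupport (pd α ϑ) := fun α => hϑc.fderiv_apply ℝ (Pi.single α 1)
  have i₀ := integrable_prod hϑ.continuous (hw₁ 0) (hv₁ j) hϑc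
  have i₁ := integrable_prod hϑ.continuous (hw₁ j) (hv₁ 0) hϑc
  have i₂ := integrable_prod (hϑ₁ j) hw.continuous (hv₁ 0) (hϑ₁c j)
  have i₃ := integrable_prod (hϑ₁ 0) hw.continuous (hv₁ j) (hϑ₁c 0)
  have i₄ : Integrable (fun x => ϑ x * b 0 x * pd 1 w x * pd j v x) :=
    integrable_prod (hϑ.continuous.mul (hb 0)) (hw₁ 1) (hv₁ j) hϑc.mul_right
  have i₅ : Integrable (fun x => ϑ x * b 1 x * pd 2 w x * pd j v x) :=
    integrable_prod (hϑ.continuous.mul (hb 1)) (hw₁ 2) (hv₁ j) hϑc.mul_right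
  have i₀₄ : Integrable (fun x => ϑ x * pd 0 w x * pd j v x
      - ϑ x * b 0 x * pd 1 w x * pd j v x) := i₀.sub i₄
  have key := integral_pd_mul_pd_comm (hϑ.mul hw) hv hϑc.mul_right 0 j
  simp only [pd_mul hϑ hw, add_mul] at key
  rw [integral_add i₀ i₃, integral_add i₁ i₂] at key
  have hsplit : ∫ x, ϑ x * e0 b w x * pd j v x =
      (∫ x, ϑ x * pd 0 w x * pd j v x) - (∫ x, (ϑ x * b 0 x) * pd 1 w x * pd j v x)
        - ∫ x, (ϑ x * b 1 x) * pd 2 w x * pd j v x := by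
    rw [← integral_sub i₀ i₄, ← integral_sub i₀₄ i₅]
    refine integral_congr_ae (Eventually.of_forall fun x => ?_)
    simp only [e0]
    ring
  rw [hsplit]
  linarith

/-- bilinear compensated compactness, cf. the treatment of terms III, IV in
Proposition `prop:main.medium` of Huneau–Luk: if `wₙ → 0` uniformly on compact sets along with
its spatial derivatives, and `∂vₙ` is bounded in `L²_loc`, then `((e₀)wₙ)·∂_j vₙ ⇀ 0` in the
sense of distributions. -/
theorem stmt13
    (b : Fin 2 → E3 → ℝ) (hb : ∀ i, ContDiff ℝ (⊤ : ℕ∞) (b i))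
    (w : ℕ → E3 → ℝ) (v : ℕ → E3 → ℝ)
    (hwreg : ∀ n, ContDiff ℝ 1 (w n)) (hvreg : ∀ n, ContDiff ℝ 2 (v n))
    (hwconv : ∀ K : Set E3, IsCompact K → TendstoUniformlyOn (fun n => w n) 0 atTop K)
    (hwspconv : ∀ K : Set E3, IsCompact K → ∀ i : Fin 3, i ≠ 0 →
      TendstoUniformlyOn (fun n => pd i (w n)) 0 atTop K)
    (hvbdd : ∀ K : Set E3, IsCompact K → ∃ C : ℝ, ∀ n, ∀ α : Fin 3,
      eLpNorm (pd α (v n)) 2 (volume.restrict K) ≤ ENNReal.ofReal C) :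
    ∀ ϑ : E3 → ℝ, ContDiff ℝ (⊤ : ℕ∞) ϑ → HasCompactSupport ϑ →
      ∀ j : Fin 3, j ≠ 0 →
        Tendsto (fun n => ∫ x, ϑ x * e0 b (w n) x * pd j (v n) x) atTop (nhds 0) := by
  intro ϑ hϑ hϑc j hj
  have hϑ' : ContDiff ℝ 1 ϑ := hϑ.of_le (by exact_mod_cast le_top)
  have hK : IsCompact (tsupport ϑ) := hϑc
  have hb' : ∀ i, Continuous (b i) := fun i => (hb i).continuous
  obtain ⟨C, hC⟩ := hvbdd _ hK
  have hϑ0 : ∀ x, x ∉ tsupport ϑ → ϑ x = 0 := fun x hx => image_eq_zero_of_notMem_tsupport hx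
  have hdϑ0 : ∀ α x, x ∉ tsupport ϑ → pd α ϑ x = 0 := fun α x hx =>
    image_eq_zero_of_notMem_tsupport fun h => hx (tsupport_pd_subset ϑ α h)
  have lim : ∀ {g : E3 → ℝ} {h : ℕ → E3 → ℝ} (α : Fin 3), Continuous g →
      (∀ x, x ∉ tsupport ϑ → g x = 0) → TendstoUniformlyOn h 0 atTop (tsupport ϑ) →
      Tendsto (fun n => ∫ x, g x * h n x * pd α (v n) x) atTop (nhds 0) :=
    fun α hg hg0 hh => tendsto_integral_mul_of_tendstoUniformlyOn hg
      (fun n => continuous_pd ((hvreg n).of_le one_le_two) α) hK hg0 hh (fun n => hC n α)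
  simp only [fun n => integral_e0_mul_pd hb' (hwreg n) (hvreg n) hϑ' hϑc j]
  have hϑb : ∀ i x, x ∉ tsupport ϑ → ϑ x * b i x = 0 := fun i x hx => by simp [hϑ0 x hx]
  simpa using ((((lim 0 hϑ.continuous hϑ0 (hwspconv _ hK j hj)).add
    (lim 0 (continuous_pd hϑ' j) (hdϑ0 j) (hwconv _ hK))).sub
    (lim j (continuous_pd hϑ' 0) (hdϑ0 0) (hwconv _ hK))).sub
    (lim j (hϑ.continuous.mul (hb' 0)) (hϑb 0) (hwspconv _ hK 1 (by decide)))).sub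
    (lim j (hϑ.continuous.mul (hb' 1)) (hϑb 1) (hwspconv _ hK 2 (by decide)))

end
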